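/- arXiv:1901.08371 — 2 statements merged into one kernel-verified Lean document; each statement's English description precedes it below -/
import Mathlib

section
/- Let q be a prime, G a commutative group of order q, and h, h₁ ∈ G. Let M ∈ (ZMod q)^{N×N} be a permutation matrix, u ∈ (ZMod q)^N, and u' = Mu. Let r̂ ∈ (ZMod q)^N and define ĉ₀ = h₁, ĉ_i = h^{r̂_i} ĉ_{i-1}^{u'_i}. Set r⋄ = r̂_N + Σ_{i=1}^{N-1} r̂_i ∏_{j=i+1}^{N} u'_j. Then for every ω₂, c ∈ ZMod q, setting s₂ = ω₂ + c·r⋄, the second verification equation holds: h^{ω₂} = (ĉ_N / h₁^{∏_{i=1}^N u_i})^{-c} · h^{s₂}. -/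
/-- Exponentiation of a monoid element by an element of `ZMod n`. -/
instance (priority := low) monoidZModPow {M : Type*} [Monoid M] {n : ℕ} :
    Pow M (ZMod n) := ⟨fun g x => g ^ x.val⟩

/-- A permutation matrix (indexed by `1, …, N`): entries are 0 or 1,
with exactly one 1 in each row and column. -/
def IsPermMatrixIcc {q : ℕ} (N : ℕ) (M : ℕ → ℕ → ZMod q) : Prop :=
  (∀ i ∈ Finset.Icc 1 N, ∀ j ∈ Finset.Icc 1 N, M i j = 0 ∨ M i j = 1) ∧
  (∀ i ∈ Finset.Icc 1 N, ∃! j, j ∈ Finset.Icc 1 N ∧ M i j = 1) ∧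
  (∀ j ∈ Finset.Icc 1 N, ∃! i, i ∈ Finset.Icc 1 N ∧ M i j = 1)

section ZModPow

variable {G : Type*} [CommGroup G] {q : ℕ}

theorem zmod_pow_def (g : G) (x : ZMod q) : g ^ x = g ^ x.val := rfl

theorem mul_zmod_pow (g k : G) (x : ZMod q) : (g * k) ^ x = g ^ x * k ^ x := by
  simp only [zmod_pow_def, mul_pow]

variable [Fintype G]

theorem zmod_pow_natCast (hcard : Fintype.card G = q) (g : G) (n : ℕ) :
    g ^ (n : ZMod q) = g ^ n := by
  rw [zmod_pow_def, ZMod.val_natCast, ← hcard, pow_mod_card]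

theorem zmod_pow_one (hcard : Fintype.card G = q) (g : G) : g ^ (1 : ZMod q) = g := by
  simpa using zmod_pow_natCast hcard g 1

variable [NeZero q]

theorem zmod_pow_add (hcard : Fintype.card G = q) (g : G) (x y : ZMod q) :
    g ^ (x + y) = g ^ x * g ^ y := by
  rw [zmod_pow_def g x, zmod_pow_def g y, ← pow_add, ← zmod_pow_natCast hcard]
  simp

theorem zmod_pow_mul (hcard : Fintype.card G = q) (g : G) (x y : ZMod q) :
    g ^ (x * y) = (g ^ x) ^ y := by
  rw [zmod_pow_def g x, zmod_pow_def _ y, ← pow_mul, ← zmod_pow_natCast hcard]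
  simp

/-- Closed form of a chain of commitments. -/
theorem chained_commitment_eq (hcard : Fintype.card G = q) (h : G) (N : ℕ) (v r : ℕ → ZMod q)
    (chat : ℕ → G)
    (hchat : ∀ i, 1 ≤ i → i ≤ N → chat i = h ^ r i * chat (i - 1) ^ v i) :
    ∀ n ≤ N, chat n = h ^ (∑ i ∈ Finset.Icc 1 n, r i * ∏ j ∈ Finset.Icc (i + 1) n, v j) *
      chat 0 ^ (∏ i ∈ Finset.Icc 1 n, v i) := by
  intro n
  induction n with
  | zero => simp [zmod_pow_one hcard, zmod_pow_def]
  | succ n ih =>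
    intro hn
    have hsum : ∑ i ∈ Finset.Icc 1 (n + 1), r i * ∏ j ∈ Finset.Icc (i + 1) (n + 1), v j =
        r (n + 1) + (∑ i ∈ Finset.Icc 1 n, r i * ∏ j ∈ Finset.Icc (i + 1) n, v j) * v (n + 1) := by
      rw [Finset.sum_Icc_succ_top (by omega), Finset.sum_mul, add_comm]
      congr 1
      · simp
      · refine Finset.sum_congr rfl fun i hi => ?_
        rw [Finset.prod_Icc_succ_top (by have := Finset.mem_Icc.mp hi; omega), mul_assoc]
    rw [hchat (n + 1) (by omega) hn, Nat.add_sub_cancel, ih (by omega), hsum,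
      Finset.prod_Icc_succ_top (by omega), mul_zmod_pow, zmod_pow_add hcard,
      zmod_pow_mul hcard, zmod_pow_mul hcard, mul_assoc]

end ZModPow

theorem IsPermMatrixIcc.prod_eq {q N : ℕ} {M : ℕ → ℕ → ZMod q} (hM : IsPermMatrixIcc N M)
    (u v : ℕ → ZMod q)
    (hv : ∀ i ∈ Finset.Icc 1 N, v i = ∑ j ∈ Finset.Icc 1 N, M i j * u j) :
    ∏ i ∈ Finset.Icc 1 N, v i = ∏ i ∈ Finset.Icc 1 N, u i := by
  obtain ⟨h01, hrow, hcol⟩ := hM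
  choose! σ hσ hσ_unique using hrow
  refine Finset.prod_nbij σ (fun i hi => (hσ i hi).1) ?_ ?_ ?_
  · intro i hi k hk hik
    have hi' := hσ i hi
    have hk' := hσ k hk
    rw [← hik] at hk'
    exact (hcol (σ i) hi'.1).unique ⟨hi, hi'.2⟩ ⟨hk, hk'.2⟩
  · intro j hj
    obtain ⟨i, hi, -⟩ := hcol j hj
    exact ⟨i, hi.1, (hσ_unique i hi.1 j ⟨hj, hi.2⟩).symm⟩
  · intro i hi
    rw [hv i hi, Finset.sum_eq_single_of_mem (σ i) (hσ i hi).1, (hσ i hi).2, one_mul]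
    intro j hj hne
    have hz : M i j = 0 :=
      (h01 i hi j hj).resolve_right fun h1 => hne (hσ_unique i hi j ⟨hj, h1⟩)
    rw [hz, zero_mul]

theorem stmt_2 {q : ℕ} [Fact (Nat.Prime q)] {G : Type*} [CommGroup G] [Fintype G]
    (hcard : Fintype.card G = q) (h h₁ : G) (N : ℕ) (hN : 1 ≤ N)
    (M : ℕ → ℕ → ZMod q) (hM : IsPermMatrixIcc N M)
    (u u' rhat : ℕ → ZMod q)
    (hu' : ∀ i ∈ Finset.Icc 1 N, u' i = ∑ j ∈ Finset.Icc 1 N, M i j * u j)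
    (chat : ℕ → G) (hchat0 : chat 0 = h₁)
    (hchat : ∀ i, 1 ≤ i → i ≤ N → chat i = h ^ rhat i * chat (i - 1) ^ u' i)
    (rdiam : ZMod q)
    (hrdiam : rdiam = rhat N +
      ∑ i ∈ Finset.Icc 1 (N - 1), rhat i * ∏ j ∈ Finset.Icc (i + 1) N, u' j)
    (ω₂ c : ZMod q) :
    h ^ ω₂ = (chat N / h₁ ^ (∏ i ∈ Finset.Icc 1 N, u i)) ^ (-c) * h ^ (ω₂ + c * rdiam) := by
  have hN0 : NeZero q := ⟨(Fact.out : Nat.Prime q).ne_zero⟩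
  have hdiam : rdiam =
      ∑ i ∈ Finset.Icc 1 N, rhat i * ∏ j ∈ Finset.Icc (i + 1) N, u' j := by
    obtain ⟨m, rfl⟩ := Nat.exists_eq_add_of_le' hN
    rw [hrdiam, Finset.sum_Icc_succ_top (by omega), add_comm]
    simp
  have hquot : chat N / h₁ ^ (∏ i ∈ Finset.Icc 1 N, u i) = h ^ rdiam := by
    rw [chained_commitment_eq hcard h N u' rhat chat hchat N le_rfl, hchat0,
      hM.prod_eq u u' hu', ← hdiam, mul_div_cancel_right]
  rw [hquot, ← zmod_pow_mul hcard, ← zmod_pow_add hcard]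
  congr 1
  ring
end

section
/- Let q be a prime, G a commutative group of order q, g ∈ G, pk ∈ G, and let Enc(m,r) = (g^r, pk^r m) ∈ G×G for m ∈ G, r ∈ ZMod q, extended componentwise to vectors of width w, and ReEnc(e,r) = e·Enc(1,r). Let M ∈ (ZMod q)^{N×N} be a permutation matrix with associated permutation π (i.e. (Mx)_i = x_{π(i)}), let e_1,…,e_N ∈ (G×G)^w, R ∈ (ZMod q)^{w×N}, and suppose e'_i = ReEnc(e_{π(i)}, R_{π(i)}) for each i, where R_k denotes the k-th column of R. Let u ∈ (ZMod q)^N, u' = Mu, and r⋆ = Ru ∈ (ZMod q)^w. Then for every c ∈ ZMod q, ω' ∈ (ZMod q)^N, and ω₄ ∈ (ZMod q)^w, setting s'_i = ω'_i + c·u'_i and s₄ = ω₄ + c·r⋆, the fourth verification equation holds: ReEnc(∏_{i=1}^N (e'_i)^{ω'_i}, -ω₄) = ReEnc((∏_{i=1}^N e_i^{u_i})^{-c} · ∏_{i=1}^N (e'_i)^{s'_i}, -s₄). -/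
/-- A permutation matrix: entries are 0 or 1, with exactly one 1 in each row and column. -/
def IsPermMatrix {N q : ℕ} (M : Matrix (Fin N) (Fin N) (ZMod q)) : Prop :=
  (∀ i j, M i j = 0 ∨ M i j = 1) ∧ (∀ i, ∃! j, M i j = 1) ∧ (∀ j, ∃! i, M i j = 1)

/-- Componentwise ElGamal encryption of a width-`w` vector of messages. -/
def EncV {G : Type*} [CommGroup G] {q w : ℕ} (g pk : G)
    (m : Fin w → G) (r : Fin w → ZMod q) : Fin w → G × G :=
  fun k => (g ^ r k, pk ^ r k * m k)

/-- Componentwise re-encryption: `ReEnc(e, r) = e · Enc(1, r)`. -/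
def ReEncV {G : Type*} [CommGroup G] {q w : ℕ} (g pk : G)
    (e : Fin w → G × G) (r : Fin w → ZMod q) : Fin w → G × G :=
  e * EncV g pk 1 r

section ZModPow

variable {G : Type*} [CommGroup G] {q : ℕ}

lemma zmodPow_eq (x : G) (a : ZMod q) : x ^ a = x ^ a.val := rfl

lemma mul_zmodPow (x y : G) (a : ZMod q) : (x * y) ^ a = x ^ a * y ^ a :=
  mul_pow x y a.val

lemma prod_zmodPow {ι : Type*} (s : Finset ι) (f : ι → G) (a : ZMod q) :
    (∏ i ∈ s, f i) ^ a = ∏ i ∈ s, f i ^ a :=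
  (Finset.prod_pow s a.val f).symm

lemma zmodPow_zero (x : G) : x ^ (0 : ZMod q) = 1 := by
  rw [zmodPow_eq, ZMod.val_zero, pow_zero]

lemma zmodPow_mul (hG : ∀ x : G, x ^ q = 1) (x : G) (a b : ZMod q) :
    x ^ (a * b) = (x ^ a) ^ b := by
  simp only [zmodPow_eq]
  rw [ZMod.val_mul, ← pow_mul, ← pow_eq_pow_mod _ (hG x)]

variable [NeZero q]

lemma zmodPow_add (hG : ∀ x : G, x ^ q = 1) (x : G) (a b : ZMod q) :
    x ^ (a + b) = x ^ a * x ^ b := by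
  simp only [zmodPow_eq]
  rw [ZMod.val_add, ← pow_add, ← pow_eq_pow_mod _ (hG x)]

lemma zmodPow_neg (hG : ∀ x : G, x ^ q = 1) (x : G) (a : ZMod q) :
    x ^ (-a) = (x ^ a)⁻¹ := by
  rw [eq_inv_iff_mul_eq_one, ← zmodPow_add hG, neg_add_cancel, zmodPow_zero]

lemma zmodPow_sum (hG : ∀ x : G, x ^ q = 1) {ι : Type*} (s : Finset ι) (x : G)
    (f : ι → ZMod q) : x ^ (∑ i ∈ s, f i) = ∏ i ∈ s, x ^ f i := by
  classical
  induction s using Finset.induction_on with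
  | empty => simp [zmodPow_zero]
  | insert a s ha ih => rw [Finset.sum_insert ha, Finset.prod_insert ha, zmodPow_add hG, ih]

/-- The verification equation in a single component, for a re-randomisation `a' i` of `a (π i)`
with base `h`. -/
lemma reencryption_check (hG : ∀ x : G, x ^ q = 1) {ι : Type*} [Fintype ι]
    (π : Equiv.Perm ι) (h : G) (a a' : ι → G) (R u ω : ι → ZMod q)
    (ha' : ∀ i, a' i = a (π i) * h ^ R (π i)) (c ω₄ : ZMod q) :
    (∏ i, a' i ^ ω i) * h ^ (-ω₄) =
      (∏ i, a i ^ u i) ^ (-c) * (∏ i, a' i ^ (ω i + c * u (π i))) *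
        h ^ (-(ω₄ + c * ∑ j, R j * u j)) := by
  have key : ∏ i, a' i ^ u (π i) = (∏ i, a i ^ u i) * h ^ ∑ j, R j * u j := by
    rw [zmodPow_sum hG, ← Finset.prod_mul_distrib,
      ← Equiv.prod_comp π fun i => a i ^ u i * h ^ (R i * u i)]
    refine Finset.prod_congr rfl fun i _ => ?_
    rw [ha', mul_zmodPow, zmodPow_mul hG]
  have split : ∏ i, a' i ^ (ω i + c * u (π i)) =
      (∏ i, a' i ^ ω i) * (∏ i, a' i ^ u (π i)) ^ c := by
    rw [prod_zmodPow, ← Finset.prod_mul_distrib]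
    refine Finset.prod_congr rfl fun i _ => ?_
    rw [zmodPow_add hG, mul_comm c, zmodPow_mul hG]
  rw [split, key, mul_zmodPow, zmodPow_neg hG, zmodPow_neg hG, zmodPow_neg hG,
    zmodPow_add hG, mul_comm c, zmodPow_mul hG, mul_inv]
  generalize (∏ i, a' i ^ ω i) = A, (∏ i, a i ^ u i) ^ c = B, h ^ ω₄ = C,
    (h ^ ∑ j, R j * u j) ^ c = D
  rw [show B⁻¹ * (A * (B * D)) * (C⁻¹ * D⁻¹) = A * C⁻¹ * (B⁻¹ * B) * (D * D⁻¹) by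
    ac_rfl]
  simp

end ZModPow

theorem stmt_4 {q : ℕ} [Fact (Nat.Prime q)] {G : Type*} [CommGroup G] [Fintype G]
    (hcard : Fintype.card G = q) {N w : ℕ} (g pk : G)
    (M : Matrix (Fin N) (Fin N) (ZMod q)) (hM : IsPermMatrix M)
    (π : Equiv.Perm (Fin N)) (hπ : ∀ (x : Fin N → ZMod q) (i : Fin N), M.mulVec x i = x (π i))
    (e e' : Fin N → Fin w → G × G) (R : Fin w → Fin N → ZMod q)
    (he' : ∀ i, e' i = ReEncV g pk (e (π i)) (fun k => R k (π i)))
    (u u' : Fin N → ZMod q) (hu' : u' = M.mulVec u)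
    (rstar : Fin w → ZMod q) (hrstar : rstar = fun k => ∑ j, R k j * u j)
    (c : ZMod q) (ω' : Fin N → ZMod q) (ω₄ : Fin w → ZMod q)
    (s' : Fin N → ZMod q) (hs' : ∀ i, s' i = ω' i + c * u' i)
    (s₄ : Fin w → ZMod q) (hs₄ : s₄ = fun k => ω₄ k + c * rstar k) :
    ReEncV g pk (∏ i, e' i ^ ω' i) (-ω₄) =
      ReEncV g pk ((∏ i, e i ^ u i) ^ (-c) * ∏ i, e' i ^ s' i) (-s₄) := by
  have hG : ∀ x : G, x ^ q = 1 := fun x => hcard ▸ pow_card_eq_one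
  have hs : ∀ i, s' i = ω' i + c * u (π i) := fun i => by rw [hs', hu', hπ]
  subst hrstar hs₄
  funext k
  refine Prod.ext ?_ ?_
  · have := reencryption_check hG π g (fun i => (e i k).1) (fun i => (e' i k).1) (R k) u ω'
      (fun i => by simp [he', ReEncV, EncV]) c (ω₄ k)
    simpa [ReEncV, EncV, hs, Prod.fst_prod] using this
  · have := reencryption_check hG π pk (fun i => (e i k).2) (fun i => (e' i k).2) (R k) u ω'
      (fun i => by simp [he', ReEncV, EncV]) c (ω₄ k)
    simpa [ReEncV, EncV, hs, Prod.snd_prod] using this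
end
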